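/- Let d ≥ 1, ℓ > 0, 1 ≤ p < ∞, and let φ be an admissible weight of growth rate μ ∈ [0,1) with constant c ≥ 1. Then there exist constants C₁, C₂ > 0, depending only on d, p, μ and c (in particular independent of ℓ), such that for every measurable function u : ℝ^d × (0,ℓ) → ℝ one has C₁ · sup_{x̄ ∈ ℝ^d} φ(x̄) ∫₀^ℓ ∫_{ℝ^d} |u(x,t)|^p e^{−|x−x̄|} dx dt ≤ sup_{z ∈ (ℤ/2)^d} φ(z) ∫₀^ℓ ∫_{C(z)} |u(x,t)|^p dx dt ≤ C₂ · sup_{x̄ ∈ ℝ^d} φ(x̄) ∫₀^ℓ ∫_{ℝ^d} |u(x,t)|^p e^{−|x−x̄|} dx dt (suprema taken in [0,∞]). In other words, the parabolic uniformly bounded space L^p_{b,φ}(0,ℓ;L^p(ℝ^d)) coincides with its exponentially weighted counterpart L̃^p_{b,φ}(0,ℓ;L^p(ℝ^d)), with equivalent norms. -/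

import Mathlib

open MeasureTheory ENNReal Real

noncomputable section

/-- The closed unit cube of `ℝ^d` centered at `z`. -/
def cube (d : ℕ) (z : EuclideanSpace ℝ (Fin d)) : Set (EuclideanSpace ℝ (Fin d)) :=
  {x | ∀ i, |x i - z i| ≤ 1 / 2}

/-- The half-integer lattice point associated to `ι : Fin d → ℤ`. -/
def latticePt (d : ℕ) (ι : Fin d → ℤ) : EuclideanSpace ℝ (Fin d) :=
  WithLp.toLp 2 fun i => (ι i : ℝ) / 2


lemma norm_sub_le_of_mem_cube {d : ℕ} {x z : EuclideanSpace ℝ (Fin d)} (hx : x ∈ cube d z) :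
    ‖x - z‖ ≤ d := by
  rw [EuclideanSpace.norm_eq]
  apply Real.sqrt_le_iff.mpr
  refine ⟨by positivity, ?_⟩
  have h : ∀ i ∈ Finset.univ, ‖(x - z) i‖ ^ 2 ≤ (1 : ℝ) := by
    intro i _
    have h1 : |x i - z i| ≤ 1 / 2 := hx i
    have h2 := abs_nonneg (x i - z i)
    simp only [PiLp.sub_apply, Real.norm_eq_abs]
    nlinarith
  have h3 := Finset.sum_le_card_nsmul _ _ _ h
  simp only [Finset.card_univ, Fintype.card_fin, nsmul_eq_mul, mul_one] at h3
  rcases Nat.eq_zero_or_pos d with rfl | hd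
  · simp
  · have : (1 : ℝ) ≤ d := by exact_mod_cast hd
    nlinarith

lemma isClosed_cube (d : ℕ) (z : EuclideanSpace ℝ (Fin d)) : IsClosed (cube d z) := by
  simp only [cube, Set.ofPred_forall]
  refine isClosed_iInter fun i => isClosed_le ?_ continuous_const
  fun_prop

/-- The unit cubes centered at the half-integer lattice cover the space. -/
lemma exists_mem_cube_latticePt {d : ℕ} (x : EuclideanSpace ℝ (Fin d)) :
    ∃ ι : Fin d → ℤ, x ∈ cube d (latticePt d ι) := by
  refine ⟨fun i => ⌊2 * x i⌋, fun i => ?_⟩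
  have h1 := Int.floor_le (2 * x i)
  have h2 := Int.lt_floor_add_one (2 * x i)
  simp only [latticePt]
  rw [abs_le]
  constructor <;> linarith

lemma latticePt_sub (d : ℕ) (ι κ : Fin d → ℤ) :
    latticePt d (ι - κ) = latticePt d ι - latticePt d κ := by
  ext i
  simp [latticePt, sub_div]

lemma summable_prod_pi_of_nonneg {f : ℤ → ℝ} (hf : Summable f) (hf0 : ∀ n, 0 ≤ f n) (d : ℕ) :
    Summable fun ι : Fin d → ℤ => ∏ i, f (ι i) := by
  induction d with
  | zero => exact Summable.of_finite
  | succ n ih =>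
    rw [← (Fin.consEquiv fun _ : Fin (n + 1) => ℤ).summable_iff]
    have h := hf.mul_of_nonneg ih hf0 fun ι => Finset.prod_nonneg fun i _ => hf0 _
    refine h.congr fun q => ?_
    simp [Fin.consEquiv, Fin.prod_univ_succ]

lemma summable_exp_neg_mul_abs_int {b : ℝ} (hb : 0 < b) :
    Summable fun n : ℤ => Real.exp (-(b * |(n : ℝ)|)) := by
  have h : Summable fun n : ℕ => Real.exp (-(b * |(n : ℝ)|)) := by
    have := Real.summable_exp_nat_mul_iff.mpr (neg_lt_zero.mpr hb)
    refine this.congr fun n => ?_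
    rw [abs_of_nonneg (Nat.cast_nonneg n)]
    ring_nf
  refine Summable.of_nat_of_neg ?_ ?_ <;> simpa using h

lemma summable_exp_neg_mul_norm_latticePt {d : ℕ} (hd : 1 ≤ d) {a : ℝ} (ha : 0 < a) :
    Summable fun ι : Fin d → ℤ => Real.exp (-(a * ‖latticePt d ι‖)) := by
  have hd' : (0 : ℝ) < d := by exact_mod_cast hd
  refine (summable_prod_pi_of_nonneg (summable_exp_neg_mul_abs_int
    (b := a / (2 * d)) (by positivity)) (fun _ => (Real.exp_pos _).le) d).of_nonneg_of_le
    (fun _ => (Real.exp_pos _).le) fun ι => ?_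
  rw [← Real.exp_sum, Finset.sum_neg_distrib, ← Finset.mul_sum]
  refine Real.exp_le_exp.mpr (neg_le_neg ?_)
  have h : ∀ i ∈ Finset.univ, |(ι i : ℝ)| ≤ 2 * ‖latticePt d ι‖ := by
    intro i _
    have := PiLp.norm_apply_le (latticePt d ι) i
    simp only [latticePt, Real.norm_eq_abs, abs_div, abs_two] at this ⊢
    linarith
  have h3 := Finset.sum_le_card_nsmul _ _ _ h
  simp only [Finset.card_univ, Fintype.card_fin, nsmul_eq_mul] at h3
  calc a / (2 * d) * ∑ i, |(ι i : ℝ)| ≤ a / (2 * d) * (d * (2 * ‖latticePt d ι‖)) := by gcongr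
    _ = a * ‖latticePt d ι‖ := by field_simp

/-- Exponential lattice sums are bounded uniformly in the center. -/
lemma tsum_exp_neg_mul_norm_sub_le {d : ℕ} (hd : 1 ≤ d) {a : ℝ} (ha : 0 < a)
    (y : EuclideanSpace ℝ (Fin d)) :
    ∑' ι : Fin d → ℤ, ENNReal.ofReal (Real.exp (-(a * ‖latticePt d ι - y‖))) ≤
      ENNReal.ofReal (Real.exp (a * d) *
        ∑' ι : Fin d → ℤ, Real.exp (-(a * ‖latticePt d ι‖))) := by
  obtain ⟨κ, hκ⟩ := exists_mem_cube_latticePt y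
  have hy := norm_sub_le_of_mem_cube hκ
  rw [ENNReal.ofReal_mul (Real.exp_pos _).le, ENNReal.ofReal_tsum_of_nonneg
    (fun _ => (Real.exp_pos _).le) (summable_exp_neg_mul_norm_latticePt hd ha),
    ← (Equiv.subRight κ).tsum_eq
      (fun ι => ENNReal.ofReal (Real.exp (-(a * ‖latticePt d ι‖)))), ← ENNReal.tsum_mul_left]
  refine ENNReal.tsum_le_tsum fun ι => ?_
  rw [← ENNReal.ofReal_mul (Real.exp_pos _).le, ← Real.exp_add]
  refine ENNReal.ofReal_le_ofReal (Real.exp_le_exp.mpr ?_)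
  simp only [Equiv.subRight_apply, latticePt_sub]
  have := norm_sub_le_norm_sub_add_norm_sub (latticePt d ι) y (latticePt d κ)
  nlinarith

lemma setLIntegral_cube_le {d : ℕ} (z : EuclideanSpace ℝ (Fin d))
    (v : EuclideanSpace ℝ (Fin d) → ℝ) (hv : ∀ x, 0 ≤ v x) :
    ∫⁻ x in cube d z, ENNReal.ofReal (v x) ≤
      ENNReal.ofReal (Real.exp d) * ∫⁻ x, ENNReal.ofReal (v x * Real.exp (-‖x - z‖)) := by
  rw [← lintegral_const_mul' _ _ ENNReal.ofReal_ne_top]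
  refine le_trans (setLIntegral_mono' (isClosed_cube d z).measurableSet fun x hx => ?_)
    (setLIntegral_le_lintegral (cube d z) _)
  rw [← ENNReal.ofReal_mul (Real.exp_pos _).le]
  refine ENNReal.ofReal_le_ofReal ?_
  have h : 1 ≤ Real.exp d * Real.exp (-‖x - z‖) := by
    rw [← Real.exp_add]
    exact Real.one_le_exp (by linarith [norm_sub_le_of_mem_cube hx])
  calc v x = v x * 1 := (mul_one _).symm
    _ ≤ v x * (Real.exp d * Real.exp (-‖x - z‖)) := mul_le_mul_of_nonneg_left h (hv x)
    _ = _ := by ring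

lemma lintegral_mul_exp_le_tsum {d : ℕ} (y : EuclideanSpace ℝ (Fin d))
    (v : EuclideanSpace ℝ (Fin d) → ℝ) (hv : ∀ x, 0 ≤ v x) :
    ∫⁻ x, ENNReal.ofReal (v x * Real.exp (-‖x - y‖)) ≤
      ∑' ι : Fin d → ℤ, ENNReal.ofReal (Real.exp d * Real.exp (-‖latticePt d ι - y‖)) *
        ∫⁻ x in cube d (latticePt d ι), ENNReal.ofReal (v x) := by
  have hcover : ⋃ ι, cube d (latticePt d ι) = Set.univ :=
    Set.eq_univ_of_forall fun x => Set.mem_iUnion.mpr (exists_mem_cube_latticePt x)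
  rw [← setLIntegral_univ, ← hcover]
  refine (lintegral_iUnion_le _ _).trans (ENNReal.tsum_le_tsum fun ι => ?_)
  rw [← lintegral_const_mul' _ _ ENNReal.ofReal_ne_top]
  refine setLIntegral_mono' (isClosed_cube d _).measurableSet fun x hx => ?_
  rw [← ENNReal.ofReal_mul (by positivity), mul_comm (v x), ← Real.exp_add]
  refine ENNReal.ofReal_le_ofReal (mul_le_mul_of_nonneg_right (Real.exp_le_exp.mpr ?_) (hv x))
  have h1 := norm_sub_le_of_mem_cube hx
  have h2 := norm_sub_le_norm_sub_add_norm_sub (latticePt d ι) x y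
  rw [norm_sub_rev (latticePt d ι) x] at h2
  linarith

/-- The parabolic uniformly bounded space `L^p_{b,φ}(0,ℓ;L^p(ℝ^d))` coincides with its
exponentially weighted counterpart; the equivalence constants depend only on
`d`, `p`, `μ` and `c`, and in particular are independent of `ℓ`. -/
theorem statement3 (d : ℕ) (hd : 1 ≤ d) (p : ℝ) (hp : 1 ≤ p)
    (μ : ℝ) (hμ0 : 0 ≤ μ) (hμ1 : μ < 1) (c : ℝ) (hc : 1 ≤ c) :
    ∃ C₁ C₂ : ℝ, 0 < C₁ ∧ 0 < C₂ ∧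
      ∀ ℓ : ℝ, 0 < ℓ →
      ∀ φ : EuclideanSpace ℝ (Fin d) → ℝ, Measurable φ →
        (∃ B : ℝ, ∀ x, φ x ≤ B) → (∀ x, 0 < φ x) →
        (∀ x y : EuclideanSpace ℝ (Fin d),
            c⁻¹ * Real.exp (-μ * ‖x - y‖) ≤ φ x / φ y ∧
            φ x / φ y ≤ c * Real.exp (μ * ‖x - y‖)) →
        ∀ u : EuclideanSpace ℝ (Fin d) → ℝ → ℝ, Measurable (Function.uncurry u) →
          ENNReal.ofReal C₁ *
              (⨆ xb : EuclideanSpace ℝ (Fin d), ENNReal.ofReal (φ xb) *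
                ∫⁻ t in Set.Ioo (0 : ℝ) ℓ,
                  ∫⁻ x, ENNReal.ofReal (|u x t| ^ p * Real.exp (-‖x - xb‖))) ≤
            (⨆ ι : Fin d → ℤ, ENNReal.ofReal (φ (latticePt d ι)) *
              ∫⁻ t in Set.Ioo (0 : ℝ) ℓ,
                ∫⁻ x in cube d (latticePt d ι), ENNReal.ofReal (|u x t| ^ p)) ∧
          (⨆ ι : Fin d → ℤ, ENNReal.ofReal (φ (latticePt d ι)) *
              ∫⁻ t in Set.Ioo (0 : ℝ) ℓ,
                ∫⁻ x in cube d (latticePt d ι), ENNReal.ofReal (|u x t| ^ p)) ≤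
            ENNReal.ofReal C₂ *
              (⨆ xb : EuclideanSpace ℝ (Fin d), ENNReal.ofReal (φ xb) *
                ∫⁻ t in Set.Ioo (0 : ℝ) ℓ,
                  ∫⁻ x, ENNReal.ofReal (|u x t| ^ p * Real.exp (-‖x - xb‖))) := by
  have ha : 0 < 1 - μ := by linarith
  set K : ℝ := Real.exp ((1 - μ) * d) *
    ∑' ι : Fin d → ℤ, Real.exp (-((1 - μ) * ‖latticePt d ι‖)) with hK
  have hK0 : 0 < K := mul_pos (Real.exp_pos _)
    ((summable_exp_neg_mul_norm_latticePt hd ha).tsum_pos (fun _ => (Real.exp_pos _).le) 0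
      (Real.exp_pos _))
  have hc0 : 0 < c := by linarith
  have hM : 0 < c * Real.exp d * K := by positivity
  refine ⟨(c * Real.exp d * K)⁻¹, Real.exp d, inv_pos.mpr hM, Real.exp_pos _, ?_⟩
  intro ℓ _ φ _ _ hφ hφμ u hu
  have hu0 : ∀ t x, 0 ≤ |u x t| ^ p := fun t x => by positivity
  constructor
  · rw [ENNReal.ofReal_inv_of_pos hM, ENNReal.inv_mul_le_iff
      (ENNReal.ofReal_pos.mpr hM).ne' ENNReal.ofReal_ne_top]
    refine iSup_le fun y => ?_
    set S := ⨆ ι : Fin d → ℤ, ENNReal.ofReal (φ (latticePt d ι)) *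
      ∫⁻ t in Set.Ioo (0 : ℝ) ℓ, ∫⁻ x in cube d (latticePt d ι), ENNReal.ofReal (|u x t| ^ p)
      with hS
    have hmeas : ∀ ι : Fin d → ℤ, Measurable fun t =>
        ∫⁻ x in cube d (latticePt d ι), ENNReal.ofReal (|u x t| ^ p) := fun ι => by
      have : Measurable fun q : EuclideanSpace ℝ (Fin d) × ℝ =>
          ENNReal.ofReal (|Function.uncurry u q| ^ p) := by fun_prop
      exact this.lintegral_prod_left'
    have hterm : ∀ ι : Fin d → ℤ, ENNReal.ofReal (φ y) *
        (ENNReal.ofReal (Real.exp d * Real.exp (-‖latticePt d ι - y‖)) *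
          ∫⁻ t in Set.Ioo (0 : ℝ) ℓ,
            ∫⁻ x in cube d (latticePt d ι), ENNReal.ofReal (|u x t| ^ p)) ≤
        ENNReal.ofReal (c * Real.exp d) * S *
          ENNReal.ofReal (Real.exp (-((1 - μ) * ‖latticePt d ι - y‖))) := fun ι => by
      have h1 : φ y ≤ c * Real.exp (μ * ‖latticePt d ι - y‖) * φ (latticePt d ι) := by
        rw [norm_sub_rev]
        exact (div_le_iff₀ (hφ _)).mp (hφμ y (latticePt d ι)).2
      have h2 : φ y * (Real.exp d * Real.exp (-‖latticePt d ι - y‖)) ≤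
          c * Real.exp d * Real.exp (-((1 - μ) * ‖latticePt d ι - y‖)) * φ (latticePt d ι) := by
        have h3 : Real.exp (-((1 - μ) * ‖latticePt d ι - y‖)) =
            Real.exp (μ * ‖latticePt d ι - y‖) * Real.exp (-‖latticePt d ι - y‖) := by
          rw [← Real.exp_add]
          ring_nf
        rw [h3]
        refine (mul_le_mul_of_nonneg_right h1 (by positivity)).trans_eq ?_
        ring
      rw [← mul_assoc, ← ENNReal.ofReal_mul (hφ y).le]
      refine (mul_le_mul_left (ENNReal.ofReal_le_ofReal h2) _).trans ?_
      rw [ENNReal.ofReal_mul (by positivity), mul_assoc, mul_right_comm _ S,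
        ← ENNReal.ofReal_mul (by positivity)]
      exact mul_le_mul_right (le_iSup (fun ι : Fin d → ℤ => ENNReal.ofReal (φ (latticePt d ι)) *
        ∫⁻ t in Set.Ioo (0 : ℝ) ℓ,
          ∫⁻ x in cube d (latticePt d ι), ENNReal.ofReal (|u x t| ^ p)) ι) _
    calc _ ≤ ENNReal.ofReal (φ y) * ∫⁻ t in Set.Ioo (0 : ℝ) ℓ, ∑' ι : Fin d → ℤ,
          ENNReal.ofReal (Real.exp d * Real.exp (-‖latticePt d ι - y‖)) *
            ∫⁻ x in cube d (latticePt d ι), ENNReal.ofReal (|u x t| ^ p) := by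
          gcongr with t
          exact lintegral_mul_exp_le_tsum y _ (hu0 t)
      _ = ∑' ι : Fin d → ℤ, ENNReal.ofReal (φ y) *
          (ENNReal.ofReal (Real.exp d * Real.exp (-‖latticePt d ι - y‖)) *
            ∫⁻ t in Set.Ioo (0 : ℝ) ℓ,
              ∫⁻ x in cube d (latticePt d ι), ENNReal.ofReal (|u x t| ^ p)) := by
          rw [lintegral_tsum fun ι => ((hmeas ι).const_mul _).aemeasurable, ENNReal.tsum_mul_left]
          simp_rw [lintegral_const_mul' _ _ ENNReal.ofReal_ne_top]
      _ ≤ ∑' ι : Fin d → ℤ, ENNReal.ofReal (c * Real.exp d) * S *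
          ENNReal.ofReal (Real.exp (-((1 - μ) * ‖latticePt d ι - y‖))) :=
          ENNReal.tsum_le_tsum hterm
      _ ≤ ENNReal.ofReal (c * Real.exp d) * S * ENNReal.ofReal K := by
          rw [ENNReal.tsum_mul_left]
          gcongr
          exact tsum_exp_neg_mul_norm_sub_le hd ha y
      _ = ENNReal.ofReal (c * Real.exp d * K) * S := by
          rw [ENNReal.ofReal_mul (by positivity : 0 ≤ c * Real.exp d), mul_right_comm]
  · refine iSup_le fun ι => ?_
    refine le_trans ?_ (mul_le_mul_right (le_iSup _ (latticePt d ι)) _)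
    rw [mul_left_comm, ← lintegral_const_mul' (ENNReal.ofReal (Real.exp d)) _ ENNReal.ofReal_ne_top]
    exact mul_le_mul_right (lintegral_mono fun t => setLIntegral_cube_le _ _ (hu0 t)) _
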